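/- arXiv:math/9806131 — 2 statements merged into one kernel-verified Lean document; each statement's English description precedes it below -/
import Mathlib

section
/- If α ≥ 0 satisfies the branching condition and α₀ ≥ 0 satisfies the α₀ condition, then for every t ≥ 0: Σ_{γ∈G₀} e^{−β|γ|} · e^{−t} Σ_{n≥0} (t^n/n!) Σ_{θ∈G} m^n(γ,θ) ≤ α₀·e^{−(1−α)t}. (This is the majorant proving the time-length bound P(TL(A^{x,0}) > t) ≤ α₀ e^{−(1−α)t} of Theorem 5.3(ii).) -/
open scoped ENNReal Classical

/-- The branching kernel `m(γ,θ) = e^{-β|θ|} 1{θ ≁ γ}` of the multitype branching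
process dominating the clan of ancestors.  Here `inc θ γ` means "θ is incompatible
with γ" and `w` is the weight (number of plaquettes) function. -/
noncomputable def contourKernel {G : Type*} (w : G → ℝ) (inc : G → G → Prop) (β : ℝ)
    (γ θ : G) : ℝ≥0∞ :=
  if inc θ γ then ENNReal.ofReal (Real.exp (-β * w θ)) else 0

/-- Iterates of the kernel: `m⁰(γ,θ) = 1{θ = γ}` and
`m^{n+1}(γ,θ) = Σ_{γ'} m(γ,γ')·m^n(γ',θ)`. -/
noncomputable def contourKernelIter {G : Type*} (w : G → ℝ) (inc : G → G → Prop) (β : ℝ) :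
    ℕ → G → G → ℝ≥0∞
  | 0, γ, θ => if θ = γ then 1 else 0
  | n + 1, γ, θ => ∑' γ' : G, contourKernel w inc β γ γ' * contourKernelIter w inc β n γ' θ

/-- Under the branching condition, the weighted row sums of the iterated kernel grow at most
geometrically. -/
theorem tsum_weight_mul_contourKernelIter_le {G : Type*} (w : G → ℝ) (inc : G → G → Prop)
    (β : ℝ) (a : ℝ≥0∞)
    (hbranch : ∀ γ : G,
      ∑' θ : G, ENNReal.ofReal (w θ) * contourKernel w inc β γ θ ≤ a * ENNReal.ofReal (w γ))
    (n : ℕ) (γ : G) :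
    ∑' θ : G, ENNReal.ofReal (w θ) * contourKernelIter w inc β n γ θ ≤
      a ^ n * ENNReal.ofReal (w γ) := by
  induction n generalizing γ with
  | zero => simp [contourKernelIter]
  | succ n ih =>
    calc ∑' θ : G, ENNReal.ofReal (w θ) * contourKernelIter w inc β (n + 1) γ θ
        = ∑' γ' : G, contourKernel w inc β γ γ' *
            ∑' θ : G, ENNReal.ofReal (w θ) * contourKernelIter w inc β n γ' θ := by
          simp only [contourKernelIter, ← ENNReal.tsum_mul_left]
          rw [ENNReal.tsum_comm]
          simp only [mul_left_comm]
      _ ≤ ∑' γ' : G, contourKernel w inc β γ γ' * (a ^ n * ENNReal.ofReal (w γ')) := by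
          gcongr with γ'
          exact ih γ'
      _ = a ^ n * ∑' γ' : G, ENNReal.ofReal (w γ') * contourKernel w inc β γ γ' := by
          rw [← ENNReal.tsum_mul_left]
          refine tsum_congr fun γ' => ?_
          ring
      _ ≤ a ^ n * (a * ENNReal.ofReal (w γ)) := by
          gcongr
          exact hbranch γ
      _ = a ^ (n + 1) * ENNReal.ofReal (w γ) := by ring

/-- The exponential series, summed in the extended nonnegative reals. -/
theorem tsum_ofReal_pow_div_factorial {x : ℝ} (hx : 0 ≤ x) :
    ∑' n : ℕ, ENNReal.ofReal (x ^ n / n.factorial) = ENNReal.ofReal (Real.exp x) := by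
  rw [← ENNReal.ofReal_tsum_of_nonneg (fun n => by positivity)
    (Real.summable_pow_div_factorial x), Real.exp_eq_exp_ℝ, NormedSpace.exp_eq_tsum_div]

/-- Majorant proving the time-length bound `P(TL(A^{x,0}) > t) ≤ α₀ e^{-(1-α)t}` of
Theorem 5.3(ii): `Σ_{γ ∋ x} e^{-β|γ|} R_t(γ) ≤ α₀ e^{-(1-α)t}`, where
`R_t(γ) = e^{-t} Σ_n (tⁿ/n!) Σ_θ m^n(γ,θ)` and `G₀` is the set of contours
containing the fixed site `x`. -/
theorem timeLength_majorant {G : Type*} [Countable G] (w : G → ℝ) (hw : ∀ γ : G, 1 ≤ w γ)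
    (inc : G → G → Prop) (β : ℝ) (α : ℝ) (hα : 0 ≤ α)
    (hbranch : ∀ γ : G,
      ∑' θ : G, ENNReal.ofReal (w θ) * contourKernel w inc β γ θ ≤
        ENNReal.ofReal α * ENNReal.ofReal (w γ))
    (G₀ : Set G) (α₀ : ℝ) (hα₀pos : 0 ≤ α₀)
    (hα₀ : ∑' γ : G₀, ENNReal.ofReal (w γ * Real.exp (-β * w γ)) ≤ ENNReal.ofReal α₀)
    (t : ℝ) (ht : 0 ≤ t) :
    ∑' γ : G₀, ENNReal.ofReal (Real.exp (-β * w γ)) *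
        (ENNReal.ofReal (Real.exp (-t)) *
          ∑' n : ℕ, ENNReal.ofReal (t ^ n / n.factorial) *
            ∑' θ : G, contourKernelIter w inc β n (γ : G) θ) ≤
      ENNReal.ofReal (α₀ * Real.exp (-(1 - α) * t)) := by
  have hrow : ∀ (n : ℕ) (γ : G), ∑' θ : G, contourKernelIter w inc β n γ θ ≤
      ENNReal.ofReal α ^ n * ENNReal.ofReal (w γ) := fun n γ =>
    (ENNReal.tsum_le_tsum fun θ =>
      le_mul_of_one_le_left zero_le (ENNReal.one_le_ofReal.2 (hw θ))).trans
      (tsum_weight_mul_contourKernelIter_le w inc β _ hbranch n γ)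
  have hseries : ∀ γ : G, ∑' n : ℕ, ENNReal.ofReal (t ^ n / n.factorial) *
      ∑' θ : G, contourKernelIter w inc β n γ θ ≤
        ENNReal.ofReal (Real.exp (α * t)) * ENNReal.ofReal (w γ) := by
    intro γ
    rw [← tsum_ofReal_pow_div_factorial (mul_nonneg hα ht), ← ENNReal.tsum_mul_right]
    refine ENNReal.tsum_le_tsum fun n => ?_
    calc _ ≤ ENNReal.ofReal (t ^ n / n.factorial) *
          (ENNReal.ofReal α ^ n * ENNReal.ofReal (w γ)) := by
          gcongr
          exact hrow n γ
      _ = _ := by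
          rw [← ENNReal.ofReal_pow hα, ← mul_assoc, ← ENNReal.ofReal_mul (by positivity),
            mul_pow, div_mul_eq_mul_div, mul_comm (t ^ n)]
  calc _ ≤ ∑' γ : G₀, ENNReal.ofReal (Real.exp (-β * w γ)) * (ENNReal.ofReal (Real.exp (-t)) *
          (ENNReal.ofReal (Real.exp (α * t)) * ENNReal.ofReal (w γ))) := by
        gcongr with γ
        exact hseries γ
    _ = (∑' γ : G₀, ENNReal.ofReal (w γ * Real.exp (-β * w γ))) *
          ENNReal.ofReal (Real.exp (-(1 - α) * t)) := by
        rw [← ENNReal.tsum_mul_right]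
        refine tsum_congr fun γ => ?_
        have hexp : -(1 - α) * t = -t + α * t := by ring
        rw [hexp, Real.exp_add, ENNReal.ofReal_mul (Real.exp_nonneg _),
          ENNReal.ofReal_mul (zero_le_one.trans (hw γ))]
        ring
    _ ≤ ENNReal.ofReal α₀ * ENNReal.ofReal (Real.exp (-(1 - α) * t)) := by
        gcongr
    _ = ENNReal.ofReal (α₀ * Real.exp (-(1 - α) * t)) := (ENNReal.ofReal_mul hα₀pos).symm
end

section
/- Let a > 0 and suppose constants α' and α₀' satisfy the branching and α₀ conditions at parameter β−a, namely Σ_{θ: θ≁γ} |θ|·e^{−(β−a)|θ|} ≤ α'·|γ| for all γ ∈ G and Σ_{γ∈G₀} |γ|·e^{−(β−a)|γ|} ≤ α₀', with α' < 1. Then Σ_{k≥1} Σ_{(γ₁,…,γ_k) k-chain} e^{a(|γ₁|+⋯+|γ_k|)} Π_{i=1}^k e^{−β|γᵢ|} ≤ α₀'/(1−α'). (This is the majorant proving the exponential-moment bound E[exp(a·SW(A^{x,t}))] ≤ α₀(β−a)/(1−α(β−a)) of Theorem 5.3(iv).) -/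
open scoped ENNReal Classical

/-- A `k`-chain of contours: a tuple `(γ₁,…,γ_k)` with `γ₁ ∈ G₀` (the contours
containing the fixed site) and `γ_{i+1} ≁ γ_i` for all `1 ≤ i < k`.  Here
`inc θ γ` means "θ is incompatible with γ". -/
def IsContourChain {G : Type*} (inc : G → G → Prop) (G₀ : Set G) {k : ℕ}
    (c : Fin k → G) : Prop :=
  (∀ h : 0 < k, c ⟨0, h⟩ ∈ G₀) ∧
    ∀ (i : ℕ) (h : i + 1 < k), inc (c ⟨i + 1, h⟩) (c ⟨i, Nat.lt_of_succ_lt h⟩)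

theorem isContourChain_cons {G : Type*} (inc : G → G → Prop) (S : Set G) {k : ℕ}
    (γ : G) (c : Fin k → G) :
    IsContourChain inc S (Fin.cons γ c : Fin (k + 1) → G) ↔
      γ ∈ S ∧ IsContourChain inc {θ | inc θ γ} c := by
  constructor
  · rintro ⟨h0, h1⟩
    refine ⟨h0 k.succ_pos, fun h => h1 0 (Nat.succ_lt_succ h), fun i h => ?_⟩
    exact h1 (i + 1) (Nat.succ_lt_succ h)
  · rintro ⟨hγ, h0, h1⟩
    refine ⟨fun _ => hγ, fun i h => ?_⟩
    cases i with
    | zero => exact h0 (Nat.lt_of_succ_lt_succ h)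
    | succ i => exact h1 i (Nat.lt_of_succ_lt_succ h)

/-- The total weight of chains starting in `S` factors through their first contour. -/
theorem tsum_isContourChain_succ {G : Type*} (inc : G → G → Prop) (e : G → ℝ≥0∞)
    (S : Set G) (k : ℕ) :
    ∑' c : Fin (k + 1) → G, (if IsContourChain inc S c then ∏ i, e (c i) else 0) =
      ∑' γ : G, if γ ∈ S then
        e γ * ∑' c : Fin k → G,
          (if IsContourChain inc {θ | inc θ γ} c then ∏ i, e (c i) else 0)
      else 0 := by
  rw [← (Fin.consEquiv fun _ : Fin (k + 1) => G).tsum_eq, ENNReal.tsum_prod']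
  refine tsum_congr fun γ => ?_
  have hcons (c : Fin k → G) :
      IsContourChain inc S (Fin.consEquiv (fun _ : Fin (k + 1) => G) (γ, c)) ↔
        γ ∈ S ∧ IsContourChain inc {θ | inc θ γ} c :=
    isContourChain_cons inc S γ c
  simp only [hcons, Fin.consEquiv_apply, Fin.prod_univ_succ, Fin.cons_zero, Fin.cons_succ]
  by_cases hγ : γ ∈ S
  · simp only [hγ, true_and, if_true, ← ENNReal.tsum_mul_left, mul_ite, mul_zero]
  · simp [hγ]

theorem tsum_isContourChain_le {G : Type*} (inc : G → G → Prop) (e W : G → ℝ≥0∞)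
    (hW : ∀ γ, 1 ≤ W γ) (A : ℝ≥0∞)
    (hA : ∀ γ, ∑' θ, (if inc θ γ then W θ * e θ else 0) ≤ A * W γ) (k : ℕ) (S : Set G) :
    ∑' c : Fin (k + 1) → G, (if IsContourChain inc S c then ∏ i, e (c i) else 0) ≤
      A ^ k * ∑' γ, if γ ∈ S then W γ * e γ else 0 := by
  induction k generalizing S with
  | zero =>
    rw [tsum_isContourChain_succ, pow_zero, one_mul]
    refine ENNReal.tsum_le_tsum fun γ => ?_
    split_ifs with hγ
    · rw [tsum_fintype, Fintype.sum_unique, Fin.prod_univ_zero, mul_comm]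
      gcongr
      split_ifs
      · exact hW γ
      · exact zero_le
    · exact le_rfl
  | succ k ih =>
    rw [tsum_isContourChain_succ, ← ENNReal.tsum_mul_left]
    refine ENNReal.tsum_le_tsum fun γ => ?_
    split_ifs with hγ
    · calc
        _ ≤ e γ * (A ^ k * (A * W γ)) := by
          gcongr
          exact (ih _).trans (mul_le_mul_right (hA γ) _)
        _ = A ^ (k + 1) * (W γ * e γ) := by ring
    · exact zero_le

/-- Display (702) of Fernández–Ferrari–García, the majorant proving the
exponential-moment bound `E[exp(a·SW(A^{x,t}))] ≤ α₀(β-a)/(1-α(β-a))` of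
Theorem 5.3(iv):  if `α' < 1` and `α₀'` satisfy the branching and `α₀` conditions
at parameter `β - a`, then
`Σ_{k≥1} Σ_{k-chains} e^{a Σᵢ|γᵢ|} Πᵢ e^{-β|γᵢ|} ≤ α₀'/(1-α')`. -/
theorem chain_expMoment_sum_le {G : Type*} [Countable G] (w : G → ℝ)
    (hw : ∀ γ : G, 1 ≤ w γ) (inc : G → G → Prop) (β : ℝ) (a : ℝ) (ha : 0 < a)
    (α' : ℝ) (hα'pos : 0 ≤ α') (hα'1 : α' < 1)
    (hbranch : ∀ γ : G,
      ∑' θ : G, (if inc θ γ then ENNReal.ofReal (w θ * Real.exp (-(β - a) * w θ)) else 0) ≤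
        ENNReal.ofReal α' * ENNReal.ofReal (w γ))
    (G₀ : Set G) (α₀' : ℝ) (hα₀'pos : 0 ≤ α₀')
    (hα₀' : ∑' γ : G₀, ENNReal.ofReal (w γ * Real.exp (-(β - a) * w γ)) ≤
      ENNReal.ofReal α₀') :
    ∑' k : ℕ, ∑' c : Fin (k + 1) → G,
        (if IsContourChain inc G₀ c then
          ENNReal.ofReal (Real.exp (a * ∑ i : Fin (k + 1), w (c i)) *
            ∏ i : Fin (k + 1), Real.exp (-β * w (c i))) else 0) ≤
      ENNReal.ofReal (α₀' / (1 - α')) := by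
  set W : G → ℝ≥0∞ := fun γ => ENNReal.ofReal (w γ)
  set e : G → ℝ≥0∞ := fun γ => ENNReal.ofReal (Real.exp (-(β - a) * w γ))
  have hWe : ∀ γ, ENNReal.ofReal (w γ * Real.exp (-(β - a) * w γ)) = W γ * e γ := fun γ =>
    ENNReal.ofReal_mul (zero_le_one.trans (hw γ))
  have hprod : ∀ (k : ℕ) (c : Fin (k + 1) → G),
      ENNReal.ofReal (Real.exp (a * ∑ i, w (c i)) * ∏ i, Real.exp (-β * w (c i))) =
        ∏ i, e (c i) := by
    intro k c
    rw [← ENNReal.ofReal_prod_of_nonneg fun i _ => (Real.exp_pos _).le, Finset.mul_sum,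
      Real.exp_sum, ← Finset.prod_mul_distrib]
    congr 1
    refine Finset.prod_congr rfl fun i _ => ?_
    rw [← Real.exp_add]
    ring_nf
  simp only [hWe] at hbranch hα₀'
  simp only [hprod]
  have hG₀ : ∑' γ, (if γ ∈ G₀ then W γ * e γ else 0) ≤ ENNReal.ofReal α₀' := by
    rw [tsum_subtype G₀ fun γ => W γ * e γ] at hα₀'
    simpa only [Set.indicator_apply] using hα₀'
  calc
    _ ≤ ∑' k : ℕ, ENNReal.ofReal α' ^ k * ENNReal.ofReal α₀' :=
      ENNReal.tsum_le_tsum fun k =>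
        (tsum_isContourChain_le inc e W (fun γ => ENNReal.one_le_ofReal.2 (hw γ)) _
          hbranch k G₀).trans (mul_le_mul_right hG₀ _)
    _ = ENNReal.ofReal (α₀' / (1 - α')) := by
      rw [ENNReal.tsum_mul_right, ENNReal.tsum_geometric,
        ENNReal.ofReal_div_of_pos (sub_pos.2 hα'1), ENNReal.ofReal_sub _ hα'pos,
        ENNReal.ofReal_one, mul_comm, div_eq_mul_inv]
end
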